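/- Let 0 < α < 1, λ > 0, T > 0, and let η be absolutely continuous on [0,T]. Then for every 0 < t ≤ T, the Caputo fractional derivative of order α of the function t ↦ ∫_0^t η(s) (t−s)^{α−1} E_{α,α}(−λ(t−s)^α) ds satisfies ∂_t^α ∫_0^t η(s) (t−s)^{α−1} E_{α,α}(−λ(t−s)^α) ds = η(t) − λ ∫_0^t η(s) (t−s)^{α−1} E_{α,α}(−λ(t−s)^α) ds. -/

import Mathlib

open MeasureTheory Set

/-- The Caputo fractional derivative of order `α ∈ (0,1)` of `u` at time `t`:
`∂_t^α u(t) = (1/Γ(1−α)) ∫_0^t u'(s) (t−s)^{−α} ds`. -/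
noncomputable def caputoDeriv (α : ℝ) (u : ℝ → ℝ) (t : ℝ) : ℝ :=
  (Real.Gamma (1 - α))⁻¹ * ∫ s in (0:ℝ)..t, deriv u s * (t - s) ^ (-α)

/-- The Mittag-Leffler function `E_{α,β}(z) = ∑_{n=0}^∞ z^n / Γ(αn+β)` for real argument. -/
noncomputable def mittagLeffler (α β z : ℝ) : ℝ :=
  ∑' n : ℕ, z ^ n / Real.Gamma (α * n + β)

/-- A function `f` is absolutely continuous on `[a,b]` iff there is an integrable `f'`
on `[a,b]` with `f x = f a + ∫_a^x f'(t) dt` for all `x ∈ [a,b]`. -/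
def AbsContOn (f : ℝ → ℝ) (a b : ℝ) : Prop :=
  ∃ f' : ℝ → ℝ, IntegrableOn f' (Icc a b) ∧
    ∀ x ∈ Icc a b, f x = f a + ∫ t in a..x, f' t


open Filter Topology

/-- The Gamma function eventually dominates every exponential: `R ^ (x - 1) * e ^ (-R) ≤ Γ(x)`. -/
lemma rpow_mul_exp_neg_le_Gamma {R x : ℝ} (hR : 0 < R) (hx : 1 ≤ x) :
    R ^ (x - 1) * Real.exp (-R) ≤ Real.Gamma x := by
  rw [Real.Gamma_eq_integral (by linarith)]
  have hint := Real.GammaIntegral_convergent (s := x) (by linarith)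
  have hsub : Ioi R ⊆ Ioi 0 := Ioi_subset_Ioi hR.le
  calc R ^ (x - 1) * Real.exp (-R) = ∫ y in Ioi R, R ^ (x - 1) * Real.exp (-y) := by
        rw [integral_const_mul, integral_exp_neg_Ioi]
    _ ≤ ∫ y in Ioi R, Real.exp (-y) * y ^ (x - 1) := by
        refine setIntegral_mono_on ((integrableOn_exp_neg_Ioi R).const_mul _) (hint.mono_set hsub)
          measurableSet_Ioi fun y hy => ?_
        rw [mul_comm]
        have := (mem_Ioi.1 hy).le
        gcongr
    _ ≤ ∫ y in Ioi 0, Real.exp (-y) * y ^ (x - 1) := by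
        refine setIntegral_mono_set hint ?_ hsub.eventuallyLE
        filter_upwards [ae_restrict_mem measurableSet_Ioi] with y hy
        exact mul_nonneg (Real.exp_nonneg _) (Real.rpow_nonneg (mem_Ioi.1 hy).le _)

lemma summable_pow_div_Gamma {α : ℝ} (hα : 0 < α) (β z : ℝ) :
    Summable fun n : ℕ => z ^ n / Real.Gamma (α * n + β) := by
  set R : ℝ := (2 * (|z| + 1)) ^ (1 / α) with hR
  have hR0 : 0 < R := by positivity
  have hRα : R ^ α = 2 * (|z| + 1) := by
    rw [hR, ← Real.rpow_mul (by positivity), one_div_mul_cancel hα.ne', Real.rpow_one]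
  have hlarge : ∀ᶠ n : ℕ in atTop, 1 ≤ α * n + β :=
    (tendsto_atTop_add_const_right _ _
      (tendsto_natCast_atTop_atTop.const_mul_atTop hα)).eventually_ge_atTop 1
  refine Summable.of_norm_bounded_eventually_nat (g := fun n : ℕ =>
    (R ^ (β - 1) * Real.exp (-R))⁻¹ * (1 / 2) ^ n)
    ((summable_geometric_of_lt_one (by norm_num) (by norm_num)).mul_left _) ?_
  filter_upwards [hlarge] with n hn
  have hΓ := rpow_mul_exp_neg_le_Gamma hR0 hn
  have hpow : R ^ (α * n + β - 1) = (2 * (|z| + 1)) ^ n * R ^ (β - 1) := by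
    rw [show α * n + β - 1 = α * n + (β - 1) by ring, Real.rpow_add hR0, Real.rpow_mul hR0.le,
      hRα, Real.rpow_natCast]
  rw [hpow] at hΓ
  have hΓ0 : 0 < Real.Gamma (α * n + β) := Real.Gamma_pos_of_pos (by linarith)
  rw [norm_div, norm_pow, Real.norm_eq_abs, Real.norm_of_nonneg hΓ0.le, div_le_iff₀ hΓ0]
  calc |z| ^ n ≤ (|z| + 1) ^ n := by gcongr; linarith
    _ = (R ^ (β - 1) * Real.exp (-R))⁻¹ * (1 / 2) ^ n *
          ((2 * (|z| + 1)) ^ n * R ^ (β - 1) * Real.exp (-R)) := by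
        rw [mul_pow, one_div, inv_pow]
        field_simp
    _ ≤ _ := by gcongr

lemma continuous_mittagLeffler {α β : ℝ} (hα : 0 < α) (hβ : 0 < β) :
    Continuous (mittagLeffler α β) := by
  refine continuous_iff_continuousAt.2 fun z => ?_
  refine ContinuousOn.continuousAt (s := Icc (z - 1) (z + 1)) ?_
    (Icc_mem_nhds (by linarith) (by linarith))
  refine continuousOn_tsum (fun n => by fun_prop)
    (summable_pow_div_Gamma hα β (|z| + 1)) fun n y hy => ?_
  have hΓ0 : 0 < Real.Gamma (α * n + β) := Real.Gamma_pos_of_pos (by positivity)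
  rw [norm_div, norm_pow, Real.norm_eq_abs, Real.norm_of_nonneg hΓ0.le]
  gcongr
  have := abs_sub_le y z 0
  have : |y - z| ≤ 1 := abs_le.2 ⟨by linarith [hy.1], by linarith [hy.2]⟩
  rw [sub_zero, sub_zero] at *
  linarith

lemma integral_rpow_mul_sub_rpow {a b x : ℝ} (ha : 0 < a) (hb : 0 < b) (hx : 0 < x) :
    ∫ s in (0:ℝ)..x, s ^ (a - 1) * (x - s) ^ (b - 1) =
      x ^ (a + b - 1) * (Real.Gamma a * Real.Gamma b / Real.Gamma (a + b)) := by
  have h := Complex.betaIntegral_scaled a b hx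
  rw [Complex.betaIntegral_eq_Gamma_mul_div _ _ (by simpa) (by simpa)] at h
  apply Complex.ofReal_injective
  rw [← intervalIntegral.integral_ofReal]
  push_cast
  rw [← Complex.Gamma_ofReal, ← Complex.Gamma_ofReal, ← Complex.Gamma_ofReal,
    Complex.ofReal_cpow hx.le]
  push_cast
  rw [← h]
  refine intervalIntegral.integral_congr fun s hs => ?_
  rw [uIcc_of_le hx.le] at hs
  rw [Complex.ofReal_cpow hs.1, Complex.ofReal_cpow (sub_nonneg.2 hs.2)]
  push_cast
  rfl

lemma intervalIntegrable_rpow_mul_sub_rpow {a b x : ℝ} (ha : 0 < a) (hb : 0 < b) (hx : 0 < x) :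
    IntervalIntegrable (fun s => s ^ (a - 1) * (x - s) ^ (b - 1)) volume 0 x := by
  apply intervalIntegral.intervalIntegrable_of_integral_ne_zero
  rw [integral_rpow_mul_sub_rpow ha hb hx]
  have := Real.Gamma_pos_of_pos ha
  have := Real.Gamma_pos_of_pos hb
  have := Real.Gamma_pos_of_pos (add_pos ha hb)
  positivity

/-- The Mittag-Leffler kernel `r ^ (α - 1) * E_{α,α}(-λ r ^ α)`. -/
noncomputable def mittagLefflerKernel (α lam r : ℝ) : ℝ :=
  r ^ (α - 1) * mittagLeffler α α (-lam * r ^ α)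

lemma hasSum_mittagLefflerKernel {α : ℝ} (hα : 0 < α) (lam : ℝ) {r : ℝ} (hr : 0 < r) :
    HasSum (fun n : ℕ => (-lam) ^ n / Real.Gamma (α * n + α) * r ^ (α * n + α - 1))
      (mittagLefflerKernel α lam r) := by
  have h := (summable_pow_div_Gamma hα α (-lam * r ^ α)).hasSum.mul_left (r ^ (α - 1))
  refine h.congr_fun fun n => ?_
  rw [mul_pow, ← Real.rpow_natCast (r ^ α), ← Real.rpow_mul hr.le,
    show α * n + α - 1 = (α - 1) + α * n by ring, Real.rpow_add hr]
  ring

/-- Termwise fractional integration of the Mittag-Leffler kernel. -/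
lemma hasSum_integral_mittagLefflerKernel_mul {α β : ℝ} (hα : 0 < α) (hβ : 0 < β) (lam : ℝ)
    {x : ℝ} (hx : 0 < x) :
    HasSum (fun n : ℕ => (-lam) ^ n / Real.Gamma (α * n + (α + β)) *
        (x ^ (α * n + α + β - 1) * Real.Gamma β))
      (∫ s in (0:ℝ)..x, mittagLefflerKernel α lam s * (x - s) ^ (β - 1)) := by
  have hpos (n : ℕ) : 0 < α * n + α := by positivity
  have hΓ (n : ℕ) : 0 < Real.Gamma (α * n + α) := Real.Gamma_pos_of_pos (hpos n)
  set F : ℕ → ℝ → ℝ := fun n s =>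
    (-lam) ^ n / Real.Gamma (α * n + α) * (s ^ (α * n + α - 1) * (x - s) ^ (β - 1)) with hF
  have hint (n : ℕ) : IntegrableOn (F n) (Ioc 0 x) :=
    ((intervalIntegrable_iff_integrableOn_Ioc_of_le hx.le).1
      (intervalIntegrable_rpow_mul_sub_rpow (hpos n) hβ hx)).const_mul _
  have hval (n : ℕ) (c : ℝ) : c / Real.Gamma (α * n + α) *
      ∫ s in Ioc 0 x, (s ^ (α * n + α - 1) * (x - s) ^ (β - 1)) =
      c / Real.Gamma (α * n + (α + β)) * (x ^ (α * n + α + β - 1) * Real.Gamma β) := by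
    rw [← intervalIntegral.integral_of_le hx.le, integral_rpow_mul_sub_rpow (hpos n) hβ hx]
    have := (hΓ n).ne'
    rw [add_assoc (α * (n : ℝ)) α β]
    field_simp
  have hnorm (n : ℕ) : ∫ s in Ioc 0 x, ‖F n s‖ =
      |lam| ^ n / Real.Gamma (α * n + (α + β)) * (x ^ (α * n + α + β - 1) * Real.Gamma β) := by
    rw [← hval, ← integral_const_mul]
    refine setIntegral_congr_fun measurableSet_Ioc fun s hs => ?_
    have h1 : 0 ≤ s ^ (α * n + α - 1) := Real.rpow_nonneg hs.1.le _
    have h2 : 0 ≤ (x - s) ^ (β - 1) := Real.rpow_nonneg (sub_nonneg.2 hs.2) _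
    simp only [hF, norm_mul, norm_div, norm_pow, norm_neg, Real.norm_eq_abs, abs_of_nonneg h1,
      abs_of_nonneg h2, abs_of_pos (hΓ n)]
  have hsum : Summable fun n => ∫ s in Ioc 0 x, ‖F n s‖ := by
    simp_rw [hnorm]
    refine ((summable_pow_div_Gamma hα (α + β) (|lam| * x ^ α)).mul_right
      (x ^ (α + β - 1) * Real.Gamma β)).congr fun n => ?_
    rw [mul_pow, ← Real.rpow_natCast (x ^ α), ← Real.rpow_mul hx.le,
      show α * n + α + β - 1 = α * n + (α + β - 1) by ring, Real.rpow_add hx]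
    ring
  have key := hasSum_integral_of_summable_integral_norm hint hsum
  have hlim : ∫ s in Ioc 0 x, ∑' n, F n s =
      ∫ s in (0:ℝ)..x, mittagLefflerKernel α lam s * (x - s) ^ (β - 1) := by
    rw [intervalIntegral.integral_of_le hx.le]
    refine setIntegral_congr_fun measurableSet_Ioc fun s hs => ?_
    have := ((hasSum_mittagLefflerKernel hα lam hs.1).mul_right ((x - s) ^ (β - 1))).tsum_eq
    simp only [← this, hF, mul_assoc]
  rw [hlim] at key
  refine key.congr_fun fun n => ?_
  rw [← hval, ← integral_const_mul]

/-- The fractional integral of order `1 - α` of the kernel is `E_{α,1}(-λ x ^ α)`, written here as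
`1 - λ ∫_0^x k`. -/
lemma integral_mittagLefflerKernel_mul_rpow_neg {α : ℝ} (hα0 : 0 < α) (hα1 : α < 1) (lam : ℝ)
    {x : ℝ} (hx : 0 < x) :
    ∫ s in (0:ℝ)..x, mittagLefflerKernel α lam s * (x - s) ^ (-α) =
      Real.Gamma (1 - α) * (1 - lam * ∫ s in (0:ℝ)..x, mittagLefflerKernel α lam s) := by
  have h1 := hasSum_integral_mittagLefflerKernel_mul hα0 (sub_pos.2 hα1) lam hx
  have h2 := hasSum_integral_mittagLefflerKernel_mul hα0 one_pos lam hx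
  simp only [sub_self, Real.rpow_zero, mul_one, Real.Gamma_one] at h2
  rw [show 1 - α - 1 = -α by ring] at h1
  have h3 := ((hasSum_nat_add_iff' 1).2 h1).unique
    ((h2.mul_left (-lam * Real.Gamma (1 - α))).congr_fun fun n => ?_)
  · simp at h3
    linarith
  · push_cast
    rw [show α * ((n : ℝ) + 1) + (α + (1 - α)) = α * n + (α + 1) by ring,
      show α * ((n : ℝ) + 1) + α + (1 - α) - 1 = α * n + α + 1 - 1 by ring]
    ring

/-- Fubini for iterated convolutions on `[0,t]`:
`((f * k) * q)(t) = (f * (k * q))(t)`, together with integrability of both outer integrands. -/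
lemma integral_convolution_assoc {f k q : ℝ → ℝ} {t C : ℝ} (ht : 0 < t)
    (hf : IntegrableOn f (Ioc 0 t)) (hk : Measurable k) (hq : Measurable q)
    (hkq : ∀ x, 0 < x → x ≤ t → IntervalIntegrable (fun s => k s * q (x - s)) volume 0 x)
    (hC : ∀ x, 0 < x → x ≤ t → ∫ s in (0:ℝ)..x, |k s * q (x - s)| ≤ C) :
    IntervalIntegrable (fun s => (∫ r in (0:ℝ)..s, f r * k (s - r)) * q (t - s)) volume 0 t ∧
    IntervalIntegrable (fun r => f r * ∫ s in (0:ℝ)..(t - r), k s * q (t - r - s)) volume 0 t ∧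
    ∫ s in (0:ℝ)..t, (∫ r in (0:ℝ)..s, f r * k (s - r)) * q (t - s) =
      ∫ r in (0:ℝ)..t, f r * ∫ s in (0:ℝ)..(t - r), k s * q (t - r - s) := by
  set K := (Ioi (0:ℝ)).indicator k with hK
  set Q := (Ioi (0:ℝ)).indicator q with hQ
  have hKm : Measurable K := hk.indicator measurableSet_Ioi
  have hQm : Measurable Q := hq.indicator measurableSet_Ioi
  set μ := volume.restrict (Ioo (0:ℝ) t) with hμ
  have hfμ : Integrable f μ := hf.mono_set Ioo_subset_Ioc_self
  set F : ℝ → ℝ → ℝ := fun r s => f r * (K (s - r) * Q (t - s)) with hF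
  have hFm : AEStronglyMeasurable (Function.uncurry F) (μ.prod volume) := by
    refine (hfμ.aestronglyMeasurable.comp_fst).mul (Measurable.aestronglyMeasurable ?_)
    exact (hKm.comp (measurable_snd.sub measurable_fst)).mul
      (hQm.comp (measurable_const.sub measurable_snd))
  have hKQ (r : ℝ) : (fun s => K (s - r) * Q (t - s)) =
      (Ioo r t).indicator fun s => k (s - r) * q (t - r - (s - r)) := by
    ext s
    simp only [hK, hQ, indicator, mem_Ioi, mem_Ioo, sub_pos, sub_sub_sub_cancel_right]
    by_cases h1 : r < s <;> by_cases h2 : s < t <;> simp [h1, h2]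
  have hshift (r : ℝ) (hr : r ∈ Ioo 0 t) :
      IntegrableOn (fun s => k (s - r) * q (t - r - (s - r))) (Ioo r t) := by
    have := (hkq (t - r) (by linarith [hr.2]) (by linarith [hr.1])).comp_sub_right r
    rw [zero_add, sub_add_cancel, intervalIntegrable_iff_integrableOn_Ioo_of_le hr.2.le] at this
    exact this
  have hintKQ (r : ℝ) (hr : r ∈ Ioo 0 t) : Integrable fun s => K (s - r) * Q (t - s) := by
    rw [hKQ, integrable_indicator_iff measurableSet_Ioo]
    exact hshift r hr
  have hvalKQ (r : ℝ) (hr : r ∈ Ioo 0 t) : ∫ s, K (s - r) * Q (t - s) =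
      ∫ s in (0:ℝ)..(t - r), k s * q (t - r - s) := by
    rw [hKQ, integral_indicator measurableSet_Ioo, ← integral_Ioc_eq_integral_Ioo,
      ← intervalIntegral.integral_of_le hr.2.le,
      intervalIntegral.integral_comp_sub_right (fun s => k s * q (t - r - s)), sub_self]
  have hbdKQ (r : ℝ) (hr : r ∈ Ioo 0 t) : ∫ s, |K (s - r) * Q (t - s)| ≤ C := by
    have h : (fun s => |K (s - r) * Q (t - s)|) =
        (Ioo r t).indicator fun s => |k (s - r) * q (t - r - (s - r))| := by
      ext s
      rw [congrFun (hKQ r) s]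
      by_cases hs : s ∈ Ioo r t <;> simp [hs]
    rw [h, integral_indicator measurableSet_Ioo, ← integral_Ioc_eq_integral_Ioo,
      ← intervalIntegral.integral_of_le hr.2.le,
      intervalIntegral.integral_comp_sub_right (fun s => |k s * q (t - r - s)|), sub_self]
    exact hC (t - r) (by linarith [hr.2]) (by linarith [hr.1])
  have hFint : Integrable (Function.uncurry F) (μ.prod volume) := by
    rw [integrable_prod_iff hFm]
    refine ⟨?_, ?_⟩
    · filter_upwards [ae_restrict_mem measurableSet_Ioo] with r hr
      exact (hintKQ r hr).const_mul (f r)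
    · refine (hfμ.norm.mul_const C).mono' hFm.norm.integral_prod_right' ?_
      filter_upwards [ae_restrict_mem measurableSet_Ioo] with r hr
      rw [Real.norm_of_nonneg (integral_nonneg fun _ => norm_nonneg _)]
      simp only [Function.uncurry, hF, norm_mul (f r), integral_const_mul]
      exact mul_le_mul_of_nonneg_left (hbdKQ r hr) (norm_nonneg _)
  have hinner (s : ℝ) (hs : s ∈ Ioo 0 t) :
      ∫ r, F r s ∂μ = (∫ r in (0:ℝ)..s, f r * k (s - r)) * q (t - s) := by
    have hQs : Q (t - s) = q (t - s) := indicator_of_mem (by simpa using hs.2) _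
    simp only [hF, ← mul_assoc, integral_mul_const, hQs]
    congr 1
    have h : (fun r => f r * K (s - r)) = (Iio s).indicator fun r => f r * k (s - r) := by
      ext r
      by_cases hr : r < s <;> simp [hK, hr, indicator]
    rw [h, hμ, integral_indicator measurableSet_Iio, Measure.restrict_restrict measurableSet_Iio,
      intervalIntegral.integral_of_le hs.1.le, integral_Ioc_eq_integral_Ioo]
    congr 2
    ext r
    simp only [mem_inter_iff, mem_Iio, mem_Ioo]
    grind
  have houter (s : ℝ) (hs : s ∉ Ioo 0 t) : ∫ r, F r s ∂μ = 0 := by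
    refine setIntegral_eq_zero_of_forall_eq_zero fun r hr => ?_
    rcases not_and_or.1 hs with h | h
    · have : K (s - r) = 0 := indicator_of_notMem (by simp; linarith [hr.1]) _
      simp [hF, this]
    · have : Q (t - s) = 0 := indicator_of_notMem (by simp; linarith) _
      simp [hF, this]
  have heq : EqOn (fun s => ∫ r, F r s ∂μ)
      (fun s => (∫ r in (0:ℝ)..s, f r * k (s - r)) * q (t - s)) (Ioo 0 t) := hinner
  have heq' : EqOn (fun r => ∫ s, F r s)
      (fun r => f r * ∫ s in (0:ℝ)..(t - r), k s * q (t - r - s)) (Ioo 0 t) := fun r hr => by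
    simp only [hF, integral_const_mul, hvalKQ r hr]
  refine ⟨?_, ?_, ?_⟩
  · rw [intervalIntegrable_iff_integrableOn_Ioo_of_le ht.le]
    exact (hFint.integral_prod_right.integrableOn).congr_fun heq measurableSet_Ioo
  · rw [intervalIntegrable_iff_integrableOn_Ioo_of_le ht.le]
    exact IntegrableOn.congr_fun hFint.integral_prod_left heq' measurableSet_Ioo
  · rw [intervalIntegral.integral_of_le ht.le, intervalIntegral.integral_of_le ht.le,
      integral_Ioc_eq_integral_Ioo, integral_Ioc_eq_integral_Ioo,
      ← setIntegral_congr_fun measurableSet_Ioo heq,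
      ← setIntegral_congr_fun measurableSet_Ioo heq',
      setIntegral_eq_integral_of_forall_compl_eq_zero houter]
    exact (integral_integral_swap hFint).symm

/-- Products of kernels with power singularities are integrable, with uniformly bounded
integral when the exponents satisfy `1 ≤ a + b`. -/
lemma integral_abs_mul_le_of_rpow_bound {k q : ℝ → ℝ} {a b t A B : ℝ} (ha : 0 < a) (hb : 0 < b)
    (hab : 1 ≤ a + b) (hk : Measurable k) (hq : Measurable q)
    (hkA : ∀ s, 0 < s → s ≤ t → |k s| ≤ A * s ^ (a - 1))
    (hqB : ∀ s, 0 < s → s ≤ t → |q s| ≤ B * s ^ (b - 1)) {x : ℝ} (hx : 0 < x) (hxt : x ≤ t) :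
    IntervalIntegrable (fun s => k s * q (x - s)) volume 0 x ∧
    ∫ s in (0:ℝ)..x, |k s * q (x - s)| ≤
      A * B * (t ^ (a + b - 1) * (Real.Gamma a * Real.Gamma b / Real.Gamma (a + b))) := by
  have hA : 0 ≤ A := by
    have := (abs_nonneg _).trans (hkA x hx hxt)
    exact nonneg_of_mul_nonneg_left this (Real.rpow_pos_of_pos hx _)
  have hB : 0 ≤ B := by
    have := (abs_nonneg _).trans (hqB x hx hxt)
    exact nonneg_of_mul_nonneg_left this (Real.rpow_pos_of_pos hx _)
  have hbound : ∀ s ∈ Ioo 0 x,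
      ‖k s * q (x - s)‖ ≤ A * B * (s ^ (a - 1) * (x - s) ^ (b - 1)) := fun s hs => by
    have h1 := hkA s hs.1 (by linarith [hs.2])
    have h2 := hqB (x - s) (by linarith [hs.2]) (by linarith [hs.1])
    have h3 := mul_le_mul h1 h2 (abs_nonneg _) ((abs_nonneg _).trans h1)
    rw [norm_mul]
    simp only [Real.norm_eq_abs]
    linarith
  have hdom := (intervalIntegrable_rpow_mul_sub_rpow ha hb hx).const_mul (A * B)
  have hint : IntervalIntegrable (fun s => k s * q (x - s)) volume 0 x := by
    rw [intervalIntegrable_iff_integrableOn_Ioo_of_le hx.le] at hdom ⊢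
    refine hdom.mono' (hk.mul (hq.comp (measurable_const.sub measurable_id))).aestronglyMeasurable
      ?_
    filter_upwards [ae_restrict_mem measurableSet_Ioo] with s hs using hbound s hs
  refine ⟨hint, ?_⟩
  have hΓa := Real.Gamma_pos_of_pos ha
  have hΓb := Real.Gamma_pos_of_pos hb
  have hΓab := Real.Gamma_pos_of_pos (add_pos ha hb)
  calc ∫ s in (0:ℝ)..x, |k s * q (x - s)|
      ≤ ∫ s in (0:ℝ)..x, A * B * (s ^ (a - 1) * (x - s) ^ (b - 1)) :=
        intervalIntegral.integral_mono_on_of_le_Ioo hx.le hint.norm hdom hbound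
    _ = A * B * (x ^ (a + b - 1) * (Real.Gamma a * Real.Gamma b / Real.Gamma (a + b))) := by
        rw [intervalIntegral.integral_const_mul, integral_rpow_mul_sub_rpow ha hb hx]
    _ ≤ _ := by
        gcongr

/-- Associativity of iterated convolutions for kernels with power singularities. -/
lemma integral_convolution_assoc_of_rpow_bound {f k q : ℝ → ℝ} {a b t A B : ℝ} (ha : 0 < a)
    (hb : 0 < b) (hab : 1 ≤ a + b) (ht : 0 < t) (hf : IntegrableOn f (Ioc 0 t))
    (hk : Measurable k) (hq : Measurable q)
    (hkA : ∀ s, 0 < s → s ≤ t → |k s| ≤ A * s ^ (a - 1))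
    (hqB : ∀ s, 0 < s → s ≤ t → |q s| ≤ B * s ^ (b - 1)) :
    IntervalIntegrable (fun s => (∫ r in (0:ℝ)..s, f r * k (s - r)) * q (t - s)) volume 0 t ∧
    IntervalIntegrable (fun r => f r * ∫ s in (0:ℝ)..(t - r), k s * q (t - r - s)) volume 0 t ∧
    ∫ s in (0:ℝ)..t, (∫ r in (0:ℝ)..s, f r * k (s - r)) * q (t - s) =
      ∫ r in (0:ℝ)..t, f r * ∫ s in (0:ℝ)..(t - r), k s * q (t - r - s) :=
  integral_convolution_assoc ht hf hk hq
    (fun _ hx hxt => (integral_abs_mul_le_of_rpow_bound ha hb hab hk hq hkA hqB hx hxt).1)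
    (fun _ hx hxt => (integral_abs_mul_le_of_rpow_bound ha hb hab hk hq hkA hqB hx hxt).2)

lemma measurable_mittagLefflerKernel {α : ℝ} (hα : 0 < α) (lam : ℝ) :
    Measurable (mittagLefflerKernel α lam) := by
  have := (continuous_mittagLeffler hα hα).measurable
  unfold mittagLefflerKernel
  fun_prop

lemma exists_abs_mittagLefflerKernel_le {α : ℝ} (hα : 0 < α) (lam T : ℝ) :
    ∃ A, ∀ s, 0 < s → s ≤ T → |mittagLefflerKernel α lam s| ≤ A * s ^ (α - 1) := by
  have hcont : Continuous fun s : ℝ => mittagLeffler α α (-lam * s ^ α) :=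
    (continuous_mittagLeffler hα hα).comp
      (continuous_const.mul (Real.continuous_rpow_const hα.le))
  obtain ⟨A, hA⟩ := isCompact_Icc.exists_bound_of_continuousOn (hcont.continuousOn (s := Icc 0 T))
  refine ⟨A, fun s hs hsT => ?_⟩
  have h0 : 0 ≤ s ^ (α - 1) := Real.rpow_nonneg hs.le _
  rw [mittagLefflerKernel, abs_mul, abs_of_nonneg h0, mul_comm]
  exact mul_le_mul_of_nonneg_right (hA s ⟨hs.le, hsT⟩) h0

/-- For `η = η₀ + ∫ g`, the convolution with the kernel `k` is the primitive of
`η₀ k + g * k`. -/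
lemma integral_add_primitive_mul_mittagLefflerKernel {α : ℝ} (hα0 : 0 < α) (lam c : ℝ) {τ : ℝ}
    (hτ : 0 < τ) {g : ℝ → ℝ} (hg : IntegrableOn g (Ioc 0 τ)) :
    IntervalIntegrable (fun s => c * mittagLefflerKernel α lam s +
      ∫ r in (0:ℝ)..s, g r * mittagLefflerKernel α lam (s - r)) volume 0 τ ∧
    IntervalIntegrable (fun r => g r * ∫ s in (0:ℝ)..(τ - r), mittagLefflerKernel α lam s)
      volume 0 τ ∧
    ∫ s in (0:ℝ)..τ, (c + ∫ r in (0:ℝ)..s, g r) * mittagLefflerKernel α lam (τ - s) =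
      ∫ s in (0:ℝ)..τ, (c * mittagLefflerKernel α lam s +
        ∫ r in (0:ℝ)..s, g r * mittagLefflerKernel α lam (s - r)) ∧
    ∫ s in (0:ℝ)..τ, (c + ∫ r in (0:ℝ)..s, g r) * mittagLefflerKernel α lam (τ - s) =
      c * (∫ s in (0:ℝ)..τ, mittagLefflerKernel α lam s) +
        ∫ r in (0:ℝ)..τ, g r * ∫ s in (0:ℝ)..(τ - r), mittagLefflerKernel α lam s := by
  set k := mittagLefflerKernel α lam with hk
  have hkm : Measurable k := measurable_mittagLefflerKernel hα0 lam
  obtain ⟨A, hA⟩ := exists_abs_mittagLefflerKernel_le hα0 lam τ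
  have hone : ∀ s : ℝ, 0 < s → s ≤ τ → |(fun _ : ℝ => (1:ℝ)) s| ≤ 1 * s ^ ((1:ℝ) - 1) := by simp
  have hk1 := (integral_abs_mul_le_of_rpow_bound hα0 one_pos (by linarith) hkm
    measurable_const hA hone hτ le_rfl).1
  have h1k := (integral_abs_mul_le_of_rpow_bound one_pos hα0 (by linarith)
    measurable_const hkm hone hA hτ le_rfl).1
  obtain ⟨hi1, hi2, he⟩ := integral_convolution_assoc_of_rpow_bound hα0 one_pos (by linarith) hτ hg
    hkm measurable_const hA hone
  obtain ⟨hj1, -, he'⟩ := integral_convolution_assoc_of_rpow_bound one_pos hα0 (by linarith) hτ hg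
    measurable_const hkm hone hA
  simp only [mul_one, one_mul, intervalIntegral.integral_comp_sub_left k, sub_self, sub_zero]
    at hk1 h1k hi1 hi2 he hj1 he'
  have hprim : ∫ s in (0:ℝ)..τ, (c + ∫ r in (0:ℝ)..s, g r) * k (τ - s) =
      c * (∫ s in (0:ℝ)..τ, k s) + ∫ r in (0:ℝ)..τ, g r * ∫ s in (0:ℝ)..(τ - r), k s := by
    simp only [add_mul]
    rw [intervalIntegral.integral_add (h1k.const_mul c) hj1, he',
      intervalIntegral.integral_const_mul, intervalIntegral.integral_comp_sub_left k, sub_self,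
      sub_zero]
  refine ⟨(hk1.const_mul c).add hi1, hi2, ?_, hprim⟩
  rw [hprim, intervalIntegral.integral_add (hk1.const_mul c) hi1, he,
    intervalIntegral.integral_const_mul]

/-- For `0 < α < 1`, `λ > 0`, `T > 0` and `η` absolutely continuous on `[0,T]`, for every
`0 < t ≤ T`:
`∂_t^α ∫_0^t η(s)(t−s)^{α−1} E_{α,α}(−λ(t−s)^α) ds
  = η(t) − λ ∫_0^t η(s)(t−s)^{α−1} E_{α,α}(−λ(t−s)^α) ds`. -/
theorem caputo_of_mittagLeffler_convolution (α lam T : ℝ)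
    (hα0 : 0 < α) (hα1 : α < 1) (hlam : 0 < lam) (hT : 0 < T)
    (η : ℝ → ℝ) (hη : AbsContOn η 0 T) :
    ∀ t : ℝ, 0 < t → t ≤ T →
      caputoDeriv α
          (fun τ => ∫ s in (0:ℝ)..τ,
            η s * (τ - s) ^ (α - 1) * mittagLeffler α α (-lam * (τ - s) ^ α)) t
        = η t - lam * ∫ s in (0:ℝ)..t,
            η s * (t - s) ^ (α - 1) * mittagLeffler α α (-lam * (t - s) ^ α) := by
  obtain ⟨g, hg, hηg⟩ := hη
  intro t ht htT
  set k := mittagLefflerKernel α lam with hk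
  have hkm : Measurable k := measurable_mittagLefflerKernel hα0 lam
  obtain ⟨A, hA⟩ := exists_abs_mittagLefflerKernel_le hα0 lam T
  have hgτ (τ : ℝ) (hτ : τ ≤ T) : IntegrableOn g (Ioc 0 τ) :=
    hg.mono_set (Ioc_subset_Icc_self.trans (Icc_subset_Icc_right hτ))
  set w : ℝ → ℝ := fun s => η 0 * k s + ∫ r in (0:ℝ)..s, g r * k (s - r) with hw
  set u : ℝ → ℝ := fun τ => ∫ s in (0:ℝ)..τ,
    η s * (τ - s) ^ (α - 1) * mittagLeffler α α (-lam * (τ - s) ^ α) with hu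
  have hukernel (τ : ℝ) (hτ : 0 < τ) (hτT : τ ≤ T) :
      u τ = ∫ s in (0:ℝ)..τ, (η 0 + ∫ r in (0:ℝ)..s, g r) * k (τ - s) := by
    refine intervalIntegral.integral_congr fun s hs => ?_
    rw [uIcc_of_le hτ.le] at hs
    simp only [hk, mittagLefflerKernel, ← hηg s ⟨hs.1, hs.2.trans hτT⟩, mul_assoc]
  have huw (τ : ℝ) (hτ : 0 < τ) (hτT : τ ≤ T) : u τ = ∫ s in (0:ℝ)..τ, w s :=
    (hukernel τ hτ hτT).trans
      (integral_add_primitive_mul_mittagLefflerKernel hα0 lam (η 0) hτ (hgτ τ hτT)).2.2.1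
  obtain ⟨hwint, hgk, -, hconv⟩ :=
    integral_add_primitive_mul_mittagLefflerKernel hα0 lam (η 0) ht (hgτ t htT)
  have hderiv : ∀ᵐ s, s ∈ Ioo 0 t → deriv u s = w s := by
    filter_upwards [hwint.ae_hasDerivAt_integral] with s hs hst
    rw [uIcc_of_le ht.le] at hs
    refine ((hs (Ioo_subset_Icc_self hst) 0 ⟨le_rfl, ht.le⟩).congr_of_eventuallyEq ?_).deriv
    filter_upwards [Ioo_mem_nhds hst.1 hst.2] with y hy
    exact huw y hy.1 (hy.2.le.trans htT)
  have hqm : Measurable fun s : ℝ => s ^ (-α) := by fun_prop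
  have hq : ∀ s : ℝ, 0 < s → s ≤ t → |s ^ (-α)| ≤ 1 * s ^ ((1 - α) - 1) := fun s hs _ => by
    rw [abs_of_nonneg (Real.rpow_nonneg hs.le _), one_mul, show 1 - α - 1 = -α by ring]
  have hA' : ∀ s, 0 < s → s ≤ t → |k s| ≤ A * s ^ (α - 1) := fun s hs hst =>
    hA s hs (hst.trans htT)
  have hkq := (integral_abs_mul_le_of_rpow_bound hα0 (sub_pos.2 hα1) (by linarith) hkm hqm hA' hq
    ht le_rfl).1
  obtain ⟨hi, -, hassoc⟩ := integral_convolution_assoc_of_rpow_bound hα0 (sub_pos.2 hα1)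
    (by linarith) ht (hgτ t htT) hkm hqm hA' hq
  have hgint : IntervalIntegrable g volume 0 t :=
    (intervalIntegrable_iff_integrableOn_Ioc_of_le ht.le).2 (hgτ t htT)
  have hΓ : Real.Gamma (1 - α) ≠ 0 := (Real.Gamma_pos_of_pos (sub_pos.2 hα1)).ne'
  have hinner : ∫ r in (0:ℝ)..t, g r * ∫ s in (0:ℝ)..(t - r), k s * (t - r - s) ^ (-α) =
      Real.Gamma (1 - α) * ((∫ r in (0:ℝ)..t, g r) -
        lam * ∫ r in (0:ℝ)..t, g r * ∫ s in (0:ℝ)..(t - r), k s) := by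
    rw [← intervalIntegral.integral_const_mul lam,
      ← intervalIntegral.integral_sub hgint (hgk.const_mul lam),
      ← intervalIntegral.integral_const_mul, intervalIntegral.integral_of_le ht.le,
      intervalIntegral.integral_of_le ht.le, integral_Ioc_eq_integral_Ioo,
      integral_Ioc_eq_integral_Ioo]
    refine setIntegral_congr_fun measurableSet_Ioo fun r hr => ?_
    simp only [hk, integral_mittagLefflerKernel_mul_rpow_neg hα0 hα1 lam (sub_pos.2 hr.2)]
    ring
  have hcaputo : ∫ s in (0:ℝ)..t, deriv u s * (t - s) ^ (-α) =
      ∫ s in (0:ℝ)..t, (η 0 * (k s * (t - s) ^ (-α)) +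
        (∫ r in (0:ℝ)..s, g r * k (s - r)) * (t - s) ^ (-α)) := by
    rw [intervalIntegral.integral_of_le ht.le, intervalIntegral.integral_of_le ht.le,
      integral_Ioc_eq_integral_Ioo, integral_Ioc_eq_integral_Ioo]
    refine setIntegral_congr_ae measurableSet_Ioo ?_
    filter_upwards [hderiv] with s hs hst
    rw [hs hst, hw]
    ring
  change (Real.Gamma (1 - α))⁻¹ * (∫ s in (0:ℝ)..t, deriv u s * (t - s) ^ (-α)) =
    η t - lam * u t
  rw [hcaputo, intervalIntegral.integral_add (hkq.const_mul _) hi,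
    intervalIntegral.integral_const_mul, hassoc, hinner, hukernel t ht htT, hconv,
    integral_mittagLefflerKernel_mul_rpow_neg hα0 hα1 lam ht, hηg t ⟨ht.le, htT⟩, ← hk]
  field_simp
  ring
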